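/- Let n ≥ 2, let σ = finRotate n be the n-cycle in S_n = Equiv.Perm (Fin n), and let P be the stabilizer of a fixed point p ∈ Fin n. If k is an integer such that the set products satisfy ⟨σ^k⟩·P = P·⟨σ^k⟩, then either ⟨σ^k⟩ = ⟨σ⟩ or σ^k is the identity; in particular, there is no subgroup of the form ⟨σ^k⟩ strictly between the trivial subgroup and ⟨σ⟩ whose set products with P commute. -/

import Mathlib

open scoped Pointwise

/-- A power of `finRotate n` that fixes one point is the identity. -/
theorem finRotate_zpow_eq_one_of_apply_eq {n : ℕ} (hn : 2 ≤ n) {p : Fin n} {j : ℤ}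
    (hj : (finRotate n ^ j) p = p) : finRotate n ^ j = 1 := by
  have hmoved (x : Fin n) : finRotate n x ≠ x := by
    rw [← Equiv.Perm.mem_support, support_finRotate_of_le hn]
    exact Finset.mem_univ x
  ext q : 1
  obtain ⟨i, rfl⟩ := (isCycle_finRotate_of_le hn).sameCycle (hmoved p) (hmoved q)
  rw [← Equiv.Perm.mul_apply, zpow_mul_comm, Equiv.Perm.mul_apply, hj, Equiv.Perm.one_apply]

/-- If the set products of a subgroup `H` of permutations with the stabilizer of `p` commute and
`H` moves `p`, then the `H`-orbit of `p` is everything. -/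
theorem exists_mem_apply_eq_of_mul_stabilizer_comm {α : Type*} {p : α}
    {H : Subgroup (Equiv.Perm α)}
    (h : (H : Set (Equiv.Perm α)) * (MulAction.stabilizer (Equiv.Perm α) p : Set (Equiv.Perm α)) =
      (MulAction.stabilizer (Equiv.Perm α) p : Set (Equiv.Perm α)) * (H : Set (Equiv.Perm α)))
    {τ : Equiv.Perm α} (hτ : τ ∈ H) (hp : τ p ≠ p) (q : α) : ∃ g ∈ H, g p = q := by
  classical
  by_cases hq : q = p
  · exact ⟨1, H.one_mem, hq.symm⟩
  have hswap : Equiv.swap (τ p) q ∈ MulAction.stabilizer (Equiv.Perm α) p :=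
    Equiv.swap_apply_of_ne_of_ne hp.symm (Ne.symm hq)
  obtain ⟨g, hg, s, hs, hgs⟩ := h.symm.subset (Set.mul_mem_mul hswap hτ)
  refine ⟨g, hg, ?_⟩
  have hsp : s p = p := hs
  simpa [hsp] using congrArg (fun f : Equiv.Perm α => f p) hgs

/-- Let `n ≥ 2`, `σ = finRotate n` the `n`-cycle in `S_n = Equiv.Perm (Fin n)`, and `P`
the stabilizer of a point `p ∈ Fin n`.  If `k` is an integer with
`⟨σ^k⟩·P = P·⟨σ^k⟩` (as set products), then `⟨σ^k⟩ = ⟨σ⟩` or `σ^k = 1`; in particular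
no subgroup `⟨σ^k⟩` strictly between the trivial subgroup and `⟨σ⟩` has commuting set
products with `P`. -/
theorem zpowers_finRotate_pow_commuting_with_stabilizer
    (n : ℕ) (hn : 2 ≤ n) (p : Fin n) (k : ℤ)
    (h : (Subgroup.zpowers (finRotate n ^ k) : Set (Equiv.Perm (Fin n))) *
          (MulAction.stabilizer (Equiv.Perm (Fin n)) p : Set (Equiv.Perm (Fin n))) =
        (MulAction.stabilizer (Equiv.Perm (Fin n)) p : Set (Equiv.Perm (Fin n))) *
          (Subgroup.zpowers (finRotate n ^ k) : Set (Equiv.Perm (Fin n)))) :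
    Subgroup.zpowers (finRotate n ^ k) = Subgroup.zpowers (finRotate n) ∨
      finRotate n ^ k = 1 := by
  refine or_iff_not_imp_right.mpr fun hk => le_antisymm ?_ ?_
  · exact Subgroup.zpowers_le.mpr (Subgroup.zpow_mem_zpowers _ k)
  · obtain ⟨g, hg, hgp⟩ := exists_mem_apply_eq_of_mul_stabilizer_comm h
      (Subgroup.mem_zpowers _) (fun hp => hk (finRotate_zpow_eq_one_of_apply_eq hn hp))
      (finRotate n p)
    obtain ⟨j, rfl⟩ := Subgroup.mem_zpowers_iff.mp hg
    have hone : finRotate n ^ (-1 + k * j) = 1 := by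
      refine finRotate_zpow_eq_one_of_apply_eq hn (p := p) ?_
      rw [zpow_add, zpow_mul, Equiv.Perm.mul_apply, hgp, zpow_neg_one, Equiv.Perm.inv_eq_iff_eq]
    rw [zpow_add, zpow_mul, zpow_neg_one, inv_mul_eq_one] at hone
    exact Subgroup.zpowers_le.mpr (by rwa [← hone] at hg)
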